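/- For every acceptance mode (σ,ρ) with σ ∈ {ran, inf} and ρ ∈ {⊓, ⊆, =}, the family of ω-languages (σ,ρ,l)-accepted by phrase structure ω-grammars equals the family of ω-languages (σ,ρ,l)-accepted by context-free ω-grammars: 𝓛_{σ,ρ,l}(ω-PSG) = 𝓛_{σ,ρ,l}(ω-CFG). -/

import Mathlib

namespace OmegaFormal

/-- σ component of an acceptance mode: `ran` (occurs at least once)
or `inf` (occurs infinitely often). -/
inductive AccSigma | ran | inf
deriving DecidableEq

/-- ρ component of an acceptance mode: `cap` (nonempty intersection, ⊓),
`sub` (⊆) or `eq` (=). -/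
inductive AccRho | cap | sub | eq
deriving DecidableEq

/-- derivation mode: leftmost (`l`) or normal (`nl`). -/
inductive DerivMode | l | nl
deriving DecidableEq

/-- `sigmaSet σ f` is ran(f) resp. inf(f). -/
def sigmaSet {Q : Type _} : AccSigma → (ℕ → Q) → Set Q
  | .ran, f => Set.range f
  | .inf, f => {q | ∀ n : ℕ, ∃ m : ℕ, n ≤ m ∧ f m = q}

/-- the binary relation denoted by ρ. -/
def rhoRel {Q : Type _} : AccRho → Set Q → Set Q → Prop
  | .cap, A, B => (A ∩ B).Nonempty
  | .sub, A, B => A ⊆ B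
  | .eq,  A, B => A = B

/-- f is (σ,ρ)-accepting w.r.t. the set 𝓕 of designated sets. -/
def IsAccepting {Q : Type _} (σ : AccSigma) (ρ : AccRho) (𝓕 : Set (Set Q)) (f : ℕ → Q) : Prop :=
  ∃ F ∈ 𝓕, rhoRel ρ (sigmaSet σ f) F

/-- the finite word `l` coincides with the prefix of the ω-word `u`. -/
def MatchesPrefix {T : Type _} (l : List T) (u : ℕ → T) : Prop :=
  ∀ (k : ℕ) (h : k < l.length), l.get ⟨k, h⟩ = u k

/-- the maximal terminal prefix of a sentential form. -/
def termPrefix {N T : Type _} : List (N ⊕ T) → List T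
  | [] => []
  | (Sum.inl _) :: _ => []
  | (Sum.inr a) :: l => a :: termPrefix l

/-- A phrase structure ω-grammar `G = (N, T, P, S, 𝓕)`:
`N` nonterminals, `T` terminals, `P` named productions `p : lhs p → rhs p`
with `lhs p ∈ N⁺`, `rhs p ∈ (N ∪ T)*`, start symbol, and
production repetition sets `acc ⊆ 2^P`. -/
structure OmegaPSG (T : Type) where
  N : Type
  [fintypeN : Fintype N]
  P : Type
  [fintypeP : Fintype P]
  lhs : P → List N
  lhs_ne : ∀ p : P, lhs p ≠ []
  rhs : P → List (N ⊕ T)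
  start : N
  acc : Set (Set P)

namespace OmegaPSG

variable {T : Type} (G : OmegaPSG T)

/-- one (normal) rewriting step using production p. -/
def Step (p : G.P) (x y : List (G.N ⊕ T)) : Prop :=
  ∃ u v : List (G.N ⊕ T),
    x = u ++ (G.lhs p).map Sum.inl ++ v ∧ y = u ++ G.rhs p ++ v

/-- one leftmost rewriting step: the rewritten occurrence starts at the
leftmost nonterminal, i.e. everything to its left is terminal. -/
def LStep (p : G.P) (x y : List (G.N ⊕ T)) : Prop :=
  ∃ u v : List (G.N ⊕ T), (∀ s ∈ u, ∃ a : T, s = Sum.inr a) ∧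
    x = u ++ (G.lhs p).map Sum.inl ++ v ∧ y = u ++ G.rhs p ++ v

def StepOf : DerivMode → G.P → List (G.N ⊕ T) → List (G.N ⊕ T) → Prop
  | .l => G.LStep
  | .nl => G.Step

/-- `L_{σ,ρ,π}(G)`: ω-words admitting an infinite π-derivation from S whose
growing terminal prefixes spell the word and whose production sequence is
(σ,ρ)-accepting w.r.t. `G.acc`. -/
def Lang (σ : AccSigma) (ρ : AccRho) (π : DerivMode) : Set (ℕ → T) :=
  {u | ∃ (s : ℕ → List (G.N ⊕ T)) (d : ℕ → G.P),
    s 0 = [Sum.inl G.start] ∧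
    (∀ i : ℕ, G.StepOf π (d i) (s i) (s (i + 1))) ∧
    (∀ n : ℕ, ∃ i : ℕ, n ≤ (termPrefix (s i)).length) ∧
    (∀ i : ℕ, MatchesPrefix (termPrefix (s i)) u) ∧
    IsAccepting σ ρ G.acc d}

/-- context-free: every left-hand side is a single nonterminal. -/
def IsCFG : Prop := ∀ p : G.P, (G.lhs p).length = 1

/-- context-sensitive (monotonic): `|β| ≥ |α|` for every production. -/
def IsCSG : Prop := ∀ p : G.P, (G.lhs p).length ≤ (G.rhs p).length

/-- right linear: productions of the form `A → uB` or `A → u`, `u ∈ T*`. -/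
def IsRLG : Prop :=
  ∀ p : G.P, (G.lhs p).length = 1 ∧
    ∃ (w : List T) (B : Option G.N),
      G.rhs p = w.map Sum.inr ++ B.toList.map Sum.inl

/-- `G` is a grammar with `$`-boundary (PSG version): with `$` = `dollar`,
`S` = `S'`, every production has one of the forms
(1) α → β, α,β ∈ N⁺ (N = nonterminals other than `$`, `S`),
(2) S → $α, α ∈ N⁺, (3) $A → a$, (4) A → ε. -/
def HasDollarBoundary (dollar S' : G.N) : Prop :=
  dollar ≠ S' ∧ G.start = S' ∧
  ∀ p : G.P,
    ((dollar ∉ G.lhs p ∧ S' ∉ G.lhs p) ∧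
      ∃ β : List G.N, β ≠ [] ∧ dollar ∉ β ∧ S' ∉ β ∧ G.rhs p = β.map Sum.inl) ∨
    (G.lhs p = [S'] ∧ ∃ α : List G.N, α ≠ [] ∧ dollar ∉ α ∧ S' ∉ α ∧
      G.rhs p = Sum.inl dollar :: α.map Sum.inl) ∨
    (∃ A : G.N, A ≠ dollar ∧ A ≠ S' ∧ G.lhs p = [dollar, A] ∧
      ∃ a : T, G.rhs p = [Sum.inr a, Sum.inl dollar]) ∨
    (∃ A : G.N, A ≠ dollar ∧ A ≠ S' ∧ G.lhs p = [A] ∧ G.rhs p = [])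

/-- `G` is a grammar with `$`-boundary (CSG version): forms (1)-(3) only,
with `|α| ≤ |β|` in form (1). -/
def HasDollarBoundaryCSG (dollar S' : G.N) : Prop :=
  dollar ≠ S' ∧ G.start = S' ∧
  ∀ p : G.P,
    ((dollar ∉ G.lhs p ∧ S' ∉ G.lhs p) ∧
      ∃ β : List G.N, β ≠ [] ∧ dollar ∉ β ∧ S' ∉ β ∧ (G.lhs p).length ≤ β.length ∧
        G.rhs p = β.map Sum.inl) ∨
    (G.lhs p = [S'] ∧ ∃ α : List G.N, α ≠ [] ∧ dollar ∉ α ∧ S' ∉ α ∧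
      G.rhs p = Sum.inl dollar :: α.map Sum.inl) ∨
    (∃ A : G.N, A ≠ dollar ∧ A ≠ S' ∧ G.lhs p = [dollar, A] ∧
      ∃ a : T, G.rhs p = [Sum.inr a, Sum.inl dollar])

end OmegaPSG

/-- `𝓛_{σ,ρ,π}(X)` for the family `X` of ω-grammars over `T` satisfying `C`. -/
def GLang (T : Type) (C : OmegaPSG T → Prop) (σ : AccSigma) (ρ : AccRho) (π : DerivMode) :
    Set (Set (ℕ → T)) :=
  {L | ∃ G : OmegaPSG T, C G ∧ L = G.Lang σ ρ π}

/-- number of non-ε labels among `b 0, …, b (i-1)`. -/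
def someCount {A : Type _} (b : ℕ → Option A) (i : ℕ) : ℕ :=
  ((Finset.range i).filter fun j => (b j).isSome = true).card

/-- the (ε-allowing) label sequence `b` concatenates to the ω-word `u`. -/
def Spells {A : Type _} (b : ℕ → Option A) (u : ℕ → A) : Prop :=
  (∀ n : ℕ, ∃ i : ℕ, n ≤ someCount b i) ∧
  ∀ i : ℕ, ∀ a : A, b i = some a → a = u (someCount b i)

/-- A finite state ω-automaton `(Q, Σ, δ, q₀, 𝓕)`. -/
structure OmegaFSA (Sig : Type) where
  Q : Type
  [fintypeQ : Fintype Q]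
  init : Q
  trans : Q → Option Sig → Q → Prop
  acc : Set (Set Q)

/-- `L_{σ,ρ}(A)` for a finite state ω-automaton. -/
def OmegaFSA.Lang {Sig : Type} (A : OmegaFSA Sig) (σ : AccSigma) (ρ : AccRho) :
    Set (ℕ → Sig) :=
  {u | ∃ (r : ℕ → A.Q) (b : ℕ → Option Sig),
    r 0 = A.init ∧ (∀ i : ℕ, A.trans (r i) (b i) (r (i + 1))) ∧
    Spells b u ∧ IsAccepting σ ρ A.acc r}

/-- `𝓛_{σ,ρ}(ω-FSA)`. -/
def FSALang (Sig : Type) (σ : AccSigma) (ρ : AccRho) : Set (Set (ℕ → Sig)) :=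
  {L | ∃ A : OmegaFSA Sig, L = A.Lang σ ρ}

/-- A pushdown ω-automaton `(Q, Σ, Γ, δ, q₀, Z₀, 𝓕)`. -/
structure OmegaPDA (Sig : Type) where
  Q : Type
  [fintypeQ : Fintype Q]
  Γ : Type
  [fintypeΓ : Fintype Γ]
  init : Q
  Z0 : Γ
  trans : Q → Option Sig → Γ → Q → List Γ → Prop
  acc : Set (Set Q)

/-- `L_{σ,ρ}(D)` for a pushdown ω-automaton. -/
def OmegaPDA.Lang {Sig : Type} (D : OmegaPDA Sig) (σ : AccSigma) (ρ : AccRho) :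
    Set (ℕ → Sig) :=
  {u | ∃ (q : ℕ → D.Q) (st : ℕ → List D.Γ) (b : ℕ → Option Sig),
    q 0 = D.init ∧ st 0 = [D.Z0] ∧
    (∀ i : ℕ, ∃ (Z : D.Γ) (γ rest : List D.Γ),
      st i = Z :: rest ∧ D.trans (q i) (b i) Z (q (i + 1)) γ ∧ st (i + 1) = γ ++ rest) ∧
    Spells b u ∧ IsAccepting σ ρ D.acc q}

/-- `𝓛_{σ,ρ}(ω-PDA)`. -/
def PDALang (Sig : Type) (σ : AccSigma) (ρ : AccRho) : Set (Set (ℕ → Sig)) :=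
  {L | ∃ D : OmegaPDA Sig, L = D.Lang σ ρ}

/-- tape head moves. -/
inductive Move | L | R | S
deriving DecidableEq

def moveHead : Move → ℕ → ℕ
  | .L, n => n - 1
  | .R, n => n + 1
  | .S, n => n

/-- A single-tape Turing ω-machine `(Q, Σ, Γ, δ, q₀, 𝓕)` (Σ ⊆ Γ via `embed`). -/
structure OmegaTM (Sig : Type) where
  Q : Type
  [fintypeQ : Fintype Q]
  Γ : Type
  [fintypeΓ : Fintype Γ]
  embed : Sig → Γ
  embed_inj : Function.Injective embed
  init : Q
  trans : Q → Γ → Q → Γ → Move → Prop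
  acc : Set (Set Q)

/-- `L_{σ,ρ}(M)`: ω-words admitting a complete non-oscillating run whose state
sequence is (σ,ρ)-accepting. -/
def OmegaTM.Lang {Sig : Type} (M : OmegaTM Sig) (σ : AccSigma) (ρ : AccRho) :
    Set (ℕ → Sig) :=
  {u | ∃ (q : ℕ → M.Q) (tape : ℕ → ℕ → M.Γ) (pos : ℕ → ℕ),
    q 0 = M.init ∧ (∀ n : ℕ, tape 0 n = M.embed (u n)) ∧ pos 0 = 0 ∧
    (∀ i : ℕ, ∃ (g : M.Γ) (m : Move),
      M.trans (q i) (tape i (pos i)) (q (i + 1)) g m ∧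
      tape (i + 1) = Function.update (tape i) (pos i) g ∧
      pos (i + 1) = moveHead m (pos i)) ∧
    (∀ n : ℕ, ∃ i : ℕ, n ≤ pos i) ∧
    (∀ n : ℕ, ∃ i0 : ℕ, ∀ i : ℕ, i0 ≤ i → pos i ≠ n) ∧
    IsAccepting σ ρ M.acc q}

/-- `𝓛_{σ,ρ}(ω-TM)`. -/
def TMLang (Sig : Type) (σ : AccSigma) (ρ : AccRho) : Set (Set (ℕ → Sig)) :=
  {L | ∃ M : OmegaTM Sig, L = M.Lang σ ρ}

/-- An m-tape Turing ω-machine. -/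
structure OmegaMTM (m : ℕ) (Sig : Type) where
  Q : Type
  [fintypeQ : Fintype Q]
  Γ : Type
  [fintypeΓ : Fintype Γ]
  embed : Sig → Γ
  embed_inj : Function.Injective embed
  blank : Γ
  init : Q
  trans : Q → (Fin m → Γ) → Q → (Fin m → Γ) → (Fin m → Move) → Prop
  acc : Set (Set Q)

/-- `L_{σ,ρ}(M)` for an m-tape Turing ω-machine (`hm : 0 < m`; the input is on
the first tape, the other tapes are initially blank; the run must be complete
and non-oscillating on the first tape). -/
def OmegaMTM.Lang {m : ℕ} {Sig : Type} (M : OmegaMTM m Sig) (hm : 0 < m)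
    (σ : AccSigma) (ρ : AccRho) : Set (ℕ → Sig) :=
  {u | ∃ (q : ℕ → M.Q) (tape : ℕ → Fin m → ℕ → M.Γ) (pos : ℕ → Fin m → ℕ),
    q 0 = M.init ∧
    (∀ n : ℕ, tape 0 ⟨0, hm⟩ n = M.embed (u n)) ∧
    (∀ j : Fin m, j ≠ ⟨0, hm⟩ → ∀ n : ℕ, tape 0 j n = M.blank) ∧
    (∀ j : Fin m, pos 0 j = 0) ∧
    (∀ i : ℕ, ∃ (g : Fin m → M.Γ) (mv : Fin m → Move),
      M.trans (q i) (fun j => tape i j (pos i j)) (q (i + 1)) g mv ∧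
      (∀ j : Fin m, tape (i + 1) j = Function.update (tape i j) (pos i j) (g j)) ∧
      (∀ j : Fin m, pos (i + 1) j = moveHead (mv j) (pos i j))) ∧
    (∀ n : ℕ, ∃ i : ℕ, n ≤ pos i ⟨0, hm⟩) ∧
    (∀ n : ℕ, ∃ i0 : ℕ, ∀ i : ℕ, i0 ≤ i → pos i ⟨0, hm⟩ ≠ n) ∧
    IsAccepting σ ρ M.acc q}

/-- `𝓛_{σ,ρ}(m-ω-TM)`. -/
def MTMLang (Sig : Type) (m : ℕ) (hm : 0 < m) (σ : AccSigma) (ρ : AccRho) :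
    Set (Set (ℕ → Sig)) :=
  {L | ∃ M : OmegaMTM m Sig, L = M.Lang hm σ ρ}

/-- the ω-language `{aⁿbⁿ | n ≥ 1}^ω` over the alphabet `Bool`
(`false` = a, `true` = b). -/
def abLang : Set (ℕ → Bool) :=
  {u | ∃ n : ℕ → ℕ, (∀ i : ℕ, 1 ≤ n i) ∧
    ∀ i k : ℕ, k < 2 * n i →
      u ((∑ j ∈ Finset.range i, 2 * n j) + k) = decide (n i ≤ k)}

end OmegaFormal

namespace OmegaFormal

section Acceptance

variable {P P' : Type}

/-- Over a finite type, `ran` and `inf` commute with relabelling. -/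
theorem image_sigmaSet [Finite P'] (h : P' → P) (σ : AccSigma) (d : ℕ → P') :
    h '' sigmaSet σ d = sigmaSet σ (h ∘ d) := by
  cases σ with
  | ran => exact (Set.range_comp h d).symm
  | inf =>
    ext q
    constructor
    · rintro ⟨p, hp, rfl⟩ n
      obtain ⟨m, hm, rfl⟩ := hp n
      exact ⟨m, hm, rfl⟩
    · intro hq
      by_contra hcon
      have hev : ∀ p : P', ∀ᶠ m in Filter.atTop, d m = p → h p ≠ q := by
        intro p
        by_cases hpq : h p = q
        · have hp : p ∉ sigmaSet .inf d := fun hp => hcon ⟨p, hp, hpq⟩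
          simp only [sigmaSet, Set.mem_ofPred_eq, not_forall, not_exists, not_and] at hp
          obtain ⟨n, hn⟩ := hp
          exact Filter.eventually_atTop.2 ⟨n, fun m hm hd => absurd hd (hn m hm)⟩
        · exact Filter.Eventually.of_forall fun _ _ => hpq
      obtain ⟨n, hn⟩ := Filter.eventually_atTop.1 (Filter.eventually_all.2 hev)
      obtain ⟨m, hm, hmq⟩ := hq n
      exact hn m hm (d m) rfl hmq

/-- A family of designated sets of `P'` for which acceptance amounts to acceptance of the
relabelled sequence with respect to `𝓕`. -/
def pullbackAcc (ρ : AccRho) (h : P' → P) (𝓕 : Set (Set P)) : Set (Set P') :=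
  match ρ with
  | .eq => {F | h '' F ∈ 𝓕}
  | _ => (fun F => h ⁻¹' F) '' 𝓕

theorem isAccepting_pullbackAcc [Finite P'] (σ : AccSigma) (ρ : AccRho) (h : P' → P)
    (𝓕 : Set (Set P)) (d : ℕ → P') :
    IsAccepting σ ρ (pullbackAcc ρ h 𝓕) d ↔ IsAccepting σ ρ 𝓕 (h ∘ d) := by
  unfold IsAccepting
  rw [← image_sigmaSet]
  cases ρ with
  | cap => simp [pullbackAcc, rhoRel, Set.image_inter_nonempty_iff]
  | sub => simp [pullbackAcc, rhoRel]
  | eq => simp [pullbackAcc, rhoRel]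

theorem exists_block {N : ℕ → ℕ} (hN : StrictMono N) (h0 : N 0 = 0) (n : ℕ) :
    ∃ i, N i ≤ n ∧ n < N (i + 1) := by
  induction n with
  | zero => exact ⟨0, h0.le, h0.symm.trans_lt (hN Nat.zero_lt_one)⟩
  | succ n ih =>
    obtain ⟨i, h1, h2⟩ := ih
    rcases Nat.lt_or_ge (n + 1) (N (i + 1)) with h | h
    · exact ⟨i, by omega, h⟩
    · exact ⟨i + 1, h, (Nat.succ_le_of_lt h2).trans_lt (hN (Nat.lt_succ_self (i + 1)))⟩

/-- Repeating each entry of a sequence finitely often changes neither `ran` nor `inf`. -/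
theorem sigmaSet_eq_of_blocks (σ : AccSigma) {f g : ℕ → P} {N : ℕ → ℕ} (hN : StrictMono N)
    (h0 : N 0 = 0) (hg : ∀ i n, N i ≤ n → n < N (i + 1) → g n = f i) :
    sigmaSet σ g = sigmaSet σ f := by
  have hgN : ∀ i, g (N i) = f i := fun i => hg i _ le_rfl (hN (Nat.lt_succ_self i))
  ext q
  cases σ with
  | ran =>
    constructor
    · rintro ⟨n, rfl⟩
      obtain ⟨i, h1, h2⟩ := exists_block hN h0 n
      exact ⟨i, (hg i n h1 h2).symm⟩
    · rintro ⟨i, rfl⟩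
      exact ⟨N i, hgN i⟩
  | inf =>
    constructor
    · intro hq n
      obtain ⟨m, hm, rfl⟩ := hq (N n)
      obtain ⟨i, h1, h2⟩ := exists_block hN h0 m
      exact ⟨i, Nat.lt_succ_iff.1 (hN.lt_iff_lt.1 (hm.trans_lt h2)), (hg i m h1 h2).symm⟩
    · intro hq n
      obtain ⟨m, hm, rfl⟩ := hq n
      exact ⟨N m, hm.trans hN.le_apply, hgN m⟩

end Acceptance

section Words

variable {N N' T : Type}

/-- A word all of whose letters are terminals. -/
def IsTerminal (u : List (N ⊕ T)) : Prop := ∀ s ∈ u, ∃ a : T, s = Sum.inr a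

/-- The number of nonterminals in a word. -/
def height (x : List (N ⊕ T)) : ℕ := x.countP Sum.isLeft

@[simp] theorem height_nil : height ([] : List (N ⊕ T)) = 0 := rfl

@[simp] theorem height_inl (A : N) (x : List (N ⊕ T)) :
    height (Sum.inl A :: x) = height x + 1 := List.countP_cons_of_pos rfl

@[simp] theorem height_inr (a : T) (x : List (N ⊕ T)) :
    height (Sum.inr a :: x) = height x := by simp [height]

@[simp] theorem height_append (x y : List (N ⊕ T)) :
    height (x ++ y) = height x + height y := List.countP_append

theorem height_le_of_suffix {x y : List (N ⊕ T)} (h : x <:+ y) : height x ≤ height y :=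
  h.sublist.countP_le

theorem IsTerminal.height_eq {u : List (N ⊕ T)} (hu : IsTerminal u) : height u = 0 := by
  refine List.countP_eq_zero.2 fun s hs => ?_
  obtain ⟨a, rfl⟩ := hu s hs
  simp

theorem IsTerminal.of_cons {s : N ⊕ T} {u : List (N ⊕ T)} (h : IsTerminal (s :: u)) :
    ∃ a, s = Sum.inr a ∧ IsTerminal u := by
  obtain ⟨a, rfl⟩ := h s (by simp)
  exact ⟨a, rfl, fun s hs => h s (by simp [hs])⟩

/-- The position of the leftmost nonterminal is unique. -/
theorem leftmost_unique {u u' v v' : List (N ⊕ T)} {A A' : N} (hu : IsTerminal u)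
    (hu' : IsTerminal u') (h : u ++ Sum.inl A :: v = u' ++ Sum.inl A' :: v') :
    u = u' ∧ A = A' ∧ v = v' := by
  induction u generalizing u' with
  | nil =>
    cases u' with
    | nil => simpa using h
    | cons s u' =>
      obtain ⟨a, rfl, -⟩ := hu'.of_cons
      simp at h
  | cons s u ih =>
    obtain ⟨a, rfl, htail⟩ := hu.of_cons
    cases u' with
    | nil => simp at h
    | cons s' u' =>
      obtain ⟨a', rfl, htail'⟩ := hu'.of_cons
      simp only [List.cons_append, List.cons.injEq] at h
      obtain ⟨rfl, rfl, rfl⟩ := ih htail htail' h.2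
      simp [h.1]

theorem termPrefix_append_inl (u v : List (N ⊕ T)) (A : N) :
    termPrefix (u ++ Sum.inl A :: v) = termPrefix u := by
  induction u with
  | nil => rfl
  | cons s u ih => cases s <;> simp [termPrefix, ih]

theorem termPrefix_map (f : N' → N) (x : List (N' ⊕ T)) :
    termPrefix (x.map (Sum.map f id)) = termPrefix x := by
  induction x with
  | nil => rfl
  | cons s u ih => cases s <;> simp [termPrefix, ih]

theorem IsTerminal.map {u : List (N' ⊕ T)} (hu : IsTerminal u) (f : N' → N) :
    IsTerminal (u.map (Sum.map f id)) := by
  intro s hs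
  obtain ⟨t, ht, rfl⟩ := List.mem_map.1 hs
  obtain ⟨a, rfl⟩ := hu t ht
  exact ⟨a, rfl⟩

/-- A suffix of `u A w` with no more nonterminals than `w` is a suffix of `w`. -/
theorem suffix_of_height_le {u v w : List (N ⊕ T)} {A : N}
    (hv : v <:+ u ++ Sum.inl A :: w) (hle : height v ≤ height w) : v <:+ w := by
  rcases List.suffix_or_suffix_of_suffix hv (List.suffix_append u (Sum.inl A :: w)) with h | h
  · rcases List.suffix_cons_iff.1 h with rfl | h
    · simp at hle
    · exact h
  · have := height_le_of_suffix h
    simp at this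
    omega

end Words

/-- What the material to the left of a position has left behind: nothing pending (`idle`), a
left-hand side matched up to, but not including, the position `c` (`mid c`), or nothing ever,
because that material is never erased (`dead`). -/
inductive Phase (α : Type) where
  | idle
  | dead
  | mid (c : α)

instance {α : Type} [Finite α] : Finite (Phase α) := by
  refine Finite.of_injective (β := Option (Option α))
    (fun q => match q with | .idle => some none | .dead => none | .mid c => some (some c)) ?_
  rintro (_ | _ | _) (_ | _ | _) h <;> simp_all

section Chain

variable {α N T : Type}

/-- The nonterminals of the word carry phases which fit together and lead from `q` to `r`;
a terminal is never crossed while a left-hand side is being matched. -/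
def Chain : Phase α → List ((Phase α × N × Phase α) ⊕ T) → Phase α → Prop
  | q, [], r => q = r
  | q, Sum.inl (a, _, b) :: w, r => a = q ∧ Chain b w r
  | q, Sum.inr _ :: w, r => (∀ c, q ≠ .mid c) ∧ Chain q w r

theorem Chain.append {q m r : Phase α} {x y : List ((Phase α × N × Phase α) ⊕ T)}
    (hx : Chain q x m) (hy : Chain m y r) : Chain q (x ++ y) r := by
  induction x generalizing q with
  | nil => cases hx; exact hy
  | cons s x ih =>
    rcases s with ⟨a, A, b⟩ | a
    · exact ⟨hx.1, ih hx.2⟩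
    · exact ⟨hx.1, ih hx.2⟩

theorem Chain.of_terminal_append {q r : Phase α} {u y : List ((Phase α × N × Phase α) ⊕ T)}
    (hu : IsTerminal u) (h : Chain q (u ++ y) r) : Chain q y r := by
  induction u with
  | nil => exact h
  | cons s u ih =>
    obtain ⟨a, rfl, htail⟩ := hu.of_cons
    exact ih htail h.2

theorem chain_idle_terminal {u : List ((Phase α × N × Phase α) ⊕ T)} (hu : IsTerminal u) :
    Chain .idle u .idle := by
  induction u with
  | nil => rfl
  | cons s u ih =>
    obtain ⟨a, rfl, htail⟩ := hu.of_cons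
    exact ⟨by simp, ih htail⟩

theorem Chain.exists_cons_of_mid {c : α} {w : List ((Phase α × N × Phase α) ⊕ T)}
    (h : Chain (.mid c) w .dead) :
    ∃ B r w', w = Sum.inl (.mid c, B, r) :: w' ∧ Chain r w' .dead := by
  match w, h with
  | [], h => cases h
  | Sum.inl (a, B, b) :: w, h => exact ⟨B, b, w, by rw [h.1], h.2⟩
  | Sum.inr a :: w, h => exact absurd rfl (h.1 c)

/-- Attach phases to the nonterminals of a word: the phase below a suffix with `t` nonterminals
is `D t`. -/
def decorate (D : ℕ → Phase α) : List (N ⊕ T) → List ((Phase α × N × Phase α) ⊕ T)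
  | [] => []
  | Sum.inl A :: w => Sum.inl (D (height w + 1), A, D (height w)) :: decorate D w
  | Sum.inr a :: w => Sum.inr a :: decorate D w

theorem map_decorate (D : ℕ → Phase α) (x : List (N ⊕ T)) :
    (decorate D x).map (Sum.map (fun X => X.2.1) id) = x := by
  induction x with
  | nil => rfl
  | cons s x ih => cases s <;> simp [decorate, ih]

theorem decorate_append (D : ℕ → Phase α) (x y : List (N ⊕ T)) :
    decorate D (x ++ y) = decorate (fun t => D (t + height y)) x ++ decorate D y := by
  induction x with
  | nil => rfl
  | cons s x ih => cases s <;> simp [decorate, ih, add_right_comm]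

theorem decorate_congr {D E : ℕ → Phase α} {x : List (N ⊕ T)}
    (h : ∀ t ≤ height x, D t = E t) : decorate D x = decorate E x := by
  induction x with
  | nil => rfl
  | cons s x ih =>
    cases s with
    | inl A =>
      simp only [height_inl] at h
      simp [decorate, ih fun t ht => h t (by omega), h (height x + 1) le_rfl,
        h (height x) (by omega)]
    | inr a => simp [decorate, ih (by simpa using h)]

theorem isTerminal_decorate (D : ℕ → Phase α) {u : List (N ⊕ T)} (hu : IsTerminal u) :
    IsTerminal (decorate D u) := by
  induction u with
  | nil => simp [IsTerminal, decorate]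
  | cons s u ih =>
    obtain ⟨a, rfl, htail⟩ := hu.of_cons
    intro t ht
    rcases List.mem_cons.1 ht with rfl | ht
    · exact ⟨a, rfl⟩
    · exact ih htail t ht

theorem decorate_terminal (D E : ℕ → Phase α) {u : List (N ⊕ T)} (hu : IsTerminal u) :
    decorate D u = decorate E u := by
  induction u with
  | nil => rfl
  | cons s u ih =>
    obtain ⟨a, rfl, htail⟩ := hu.of_cons
    simp [decorate, ih htail]

theorem chain_decorate {D : ℕ → Phase α} {x : List (N ⊕ T)}
    (h : ∀ a v, Sum.inr a :: v <:+ x → ∀ c, D (height v) ≠ .mid c) :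
    Chain (D (height x)) (decorate D x) (D 0) := by
  induction x with
  | nil => rfl
  | cons s x ih =>
    have ih := ih fun a v hv => h a v (hv.trans (List.suffix_cons _ _))
    cases s with
    | inl A => exact ⟨by simp, ih⟩
    | inr a => exact ⟨by simpa using h a x (List.suffix_refl _), by simpa using ih⟩

end Chain

namespace OmegaPSG

variable {T : Type} (G : OmegaPSG T)

/-- A production together with a position in its left-hand side. -/
abbrev Cursor : Type := Σ p : G.P, Fin (G.lhs p).length

/-- The phase in which the symbol at the cursor is consumed. -/
def phase (c : G.Cursor) : Phase G.Cursor := if c.2.val = 0 then .idle else .mid c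

/-- The symbol at the cursor. -/
def symbol (c : G.Cursor) : G.N := (G.lhs c.1)[c.2]

/-- Nonterminals annotated with the phases before and after the erasure of the material they
generate. -/
abbrev TripleN : Type := Phase G.Cursor × G.N × Phase G.Cursor

/-- Forget the phases in a word. -/
abbrev forget (x : List (G.TripleN ⊕ T)) : List (G.N ⊕ T) :=
  x.map (Sum.map (fun X => X.2.1) id)

/-- Consuming the symbol at cursor `c` leads to phase `r` and leaves the word `l`: nothing, if
the left-hand side continues after `c`, and an annotated right-hand side if it ends there. -/
def ValidRule (x : G.Cursor × Phase G.Cursor × List (G.TripleN ⊕ T)) : Prop :=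
  (∃ h : x.1.2.val + 1 < (G.lhs x.1.1).length,
    x.2.2 = [] ∧ x.2.1 = .mid ⟨x.1.1, ⟨x.1.2.val + 1, h⟩⟩) ∨
  (x.1.2.val + 1 = (G.lhs x.1.1).length ∧ G.forget x.2.2 = G.rhs x.1.1 ∧
    Chain .idle x.2.2 x.2.1)

/-- The productions of the simulating context-free grammar. -/
abbrev TripleP : Type :=
  {x : G.Cursor × Phase G.Cursor × List (G.TripleN ⊕ T) // G.ValidRule x}

instance : Finite G.N := @Finite.of_fintype _ G.fintypeN
instance : Finite G.P := @Finite.of_fintype _ G.fintypeP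

instance [Finite T] : Finite G.TripleP := by
  obtain ⟨M, hM⟩ := (Set.finite_range fun p => (G.rhs p).length).bddAbove
  refine Set.Finite.subset (Set.finite_univ (α := G.Cursor).prod
    ((Set.finite_univ (α := Phase G.Cursor)).prod (List.finite_length_le (G.TripleN ⊕ T) M))) ?_
  rintro ⟨c, r, l⟩ (⟨-, h, -⟩ | ⟨-, h, -⟩)
  · simp_all
  · have h1 := hM ⟨c.1, rfl⟩
    have h2 := congrArg List.length h
    simp at h1 h2 ⊢
    omega

/-- The context-free grammar simulating the leftmost derivations of `G`. -/
noncomputable def toCFG [Finite T] (ρ : AccRho) : OmegaPSG T where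
  N := G.TripleN
  fintypeN := Fintype.ofFinite _
  P := G.TripleP
  fintypeP := Fintype.ofFinite _
  lhs x := [(G.phase x.1.1, G.symbol x.1.1, x.1.2.1)]
  lhs_ne _ := by simp
  rhs x := x.1.2.2
  start := (.idle, G.start, .dead)
  acc := pullbackAcc ρ (fun x : G.TripleP => x.1.1.1) G.acc

theorem lhs_length_pos (p : G.P) : 0 < (G.lhs p).length := List.length_pos_iff.2 (G.lhs_ne p)

variable {G}

theorem eq_of_phase_eq_mid {c c' : G.Cursor} (h : G.phase c = .mid c') : c = c' := by
  unfold phase at h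
  split at h <;> simp_all

theorem eq_zero_of_phase_eq_idle {c : G.Cursor} (h : G.phase c = .idle) : c.2.val = 0 := by
  unfold phase at h
  split at h <;> simp_all

section Soundness

variable {s : ℕ → List (G.TripleN ⊕ T)} {d : ℕ → G.TripleP}

/-- One leftmost step of the simulating grammar, on annotated words. -/
def TripleStep (x : G.TripleP) (y z : List (G.TripleN ⊕ T)) : Prop :=
  ∃ u v, IsTerminal u ∧ y = u ++ Sum.inl (G.phase x.1.1, G.symbol x.1.1, x.1.2.1) :: v ∧
    z = u ++ x.1.2.2 ++ v

theorem toCFG_LStep_iff [Finite T] {ρ : AccRho} {x : G.TripleP} {y z : List (G.TripleN ⊕ T)} :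
    (G.toCFG ρ).LStep x y z ↔ TripleStep x y z := by
  unfold LStep TripleStep IsTerminal
  simp only [List.append_assoc]
  exact Iff.rfl

/-- Starting from an idle annotated word, the simulating grammar consumes a whole left-hand
side of `G` and produces the corresponding right-hand side. -/
theorem simulate_block (hs : ∀ n, TripleStep (d n) (s n) (s (n + 1))) {n : ℕ}
    (hn : Chain .idle (s n) .dead) {p : G.P} (hp : (d n).1.1.1 = p) :
    G.LStep p (G.forget (s n)) (G.forget (s (n + (G.lhs p).length))) ∧
    Chain .idle (s (n + (G.lhs p).length)) .dead ∧
    ∀ j < (G.lhs p).length, (d (n + j)).1.1.1 = p ∧ termPrefix (s (n + j)) = termPrefix (s n) := by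
  obtain ⟨u, v, hu, hy, hz⟩ := hs n
  have key : ∀ (j : ℕ) (hj : j < (G.lhs p).length), (d (n + j)).1.1 = ⟨p, ⟨j, hj⟩⟩ ∧
      ∃ w, s (n + j) = u ++ Sum.inl (G.phase ⟨p, ⟨j, hj⟩⟩, (G.lhs p)[j], (d (n + j)).1.2.1) :: w ∧
        s (n + j + 1) = u ++ (d (n + j)).1.2.2 ++ w ∧ Chain (d (n + j)).1.2.1 w .dead ∧
        G.forget (s n) = G.forget u ++ ((G.lhs p).take (j + 1)).map Sum.inl ++ G.forget w := by
    intro j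
    induction j with
    | zero =>
      intro hj
      have hc := hn
      rw [hy] at hc
      have hc := hc.of_terminal_append hu
      have h0 := eq_zero_of_phase_eq_idle hc.1
      have hd : (d n).1.1 = ⟨p, ⟨0, hj⟩⟩ := by
        generalize (d n).1.1 = c at *
        obtain ⟨p', k⟩ := c
        subst hp
        exact congrArg (Sigma.mk p') (Fin.ext h0)
      refine ⟨hd, v, ?_, hz, hc.2, ?_⟩
      · rw [hd] at hy
        exact hy
      · rw [hy, hd]
        simp [symbol, List.take_one, List.head?_eq_getElem?, hj]
    | succ j ih =>
      intro hj
      obtain ⟨hd, w, -, hz, hc, hf⟩ := ih (by omega)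
      rw [← Nat.add_assoc]
      obtain ⟨u', v', hu', hy', hz'⟩ := hs (n + j + 1)
      have hval := (d (n + j)).2
      simp only [ValidRule] at hval
      rw [hd] at hval
      rcases hval with ⟨h, hl, hr⟩ | ⟨h, -⟩
      · rw [hr] at hc
        obtain ⟨B, r, w', rfl, hcw⟩ := hc.exists_cons_of_mid
        rw [hl, hy', List.append_nil] at hz
        obtain ⟨rfl, hX, rfl⟩ := leftmost_unique hu' hu hz
        simp only [Prod.mk.injEq] at hX
        obtain ⟨hph, rfl, rfl⟩ := hX
        have hd' := eq_of_phase_eq_mid hph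
        refine ⟨hd', v', ?_, hz', hcw, ?_⟩
        · rw [hy', hd']
          rfl
        · rw [hf, hd', ← List.take_concat_get' _ _ hj]
          simp only [List.map_append, List.map_cons, List.map_nil, List.append_assoc,
            List.cons_append, List.nil_append]
          rfl
      · simp at h
        omega
  have hpos := G.lhs_length_pos p
  obtain ⟨L, hL⟩ : ∃ L, (G.lhs p).length = L + 1 := ⟨(G.lhs p).length - 1, by omega⟩
  obtain ⟨hd, w, hyL, hzL, hc, hf⟩ := key L (by omega)
  have hval := (d (n + L)).2
  simp only [ValidRule] at hval
  rw [hd] at hval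
  rcases hval with ⟨h, -⟩ | ⟨-, hl, hch⟩
  · simp at h
    omega
  refine ⟨⟨G.forget u, G.forget w, hu.map _, ?_, ?_⟩, ?_, ?_⟩
  · rw [hf, ← hL, List.take_length]
  · rw [hL, ← Nat.add_assoc, hzL]
    simp [forget] at hl ⊢
    rw [hl]
  · rw [hL, ← Nat.add_assoc, hzL, List.append_assoc]
    exact (chain_idle_terminal hu).append (hch.append hc)
  · intro j hj
    obtain ⟨hdj, w', hyj, -⟩ := key j hj
    refine ⟨by rw [hdj], ?_⟩
    rw [hyj, hy, termPrefix_append_inl, termPrefix_append_inl]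

end Soundness

theorem toCFG_Lang_subset [Finite T] (σ : AccSigma) (ρ : AccRho) :
    (G.toCFG ρ).Lang σ ρ .l ⊆ G.Lang σ ρ .l := by
  rintro x ⟨s, d, hs0, hs, hgrow, hmatch, hacc⟩
  change ℕ → List (G.TripleN ⊕ T) at s
  change ℕ → G.TripleP at d
  have hs : ∀ n, TripleStep (d n) (s n) (s (n + 1)) := fun n => toCFG_LStep_iff.1 (hs n)
  let tag : ℕ → G.P := fun n => (d n).1.1.1
  let N : ℕ → ℕ := fun i => Nat.rec 0 (fun _ m => m + (G.lhs (tag m)).length) i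
  have hNsucc : ∀ i, N (i + 1) = N i + (G.lhs (tag (N i))).length := fun _ => rfl
  have hN : StrictMono N := strictMono_nat_of_lt_succ fun i => by
    have := G.lhs_length_pos (tag (N i))
    rw [hNsucc]
    omega
  have hidle : ∀ i, Chain .idle (s (N i)) .dead := by
    intro i
    induction i with
    | zero =>
      change Chain .idle (s 0) .dead
      rw [hs0]
      exact ⟨rfl, rfl⟩
    | succ i ih => exact (simulate_block hs ih rfl).2.1
  have hblock : ∀ i n, N i ≤ n → n < N (i + 1) →
      tag n = tag (N i) ∧ termPrefix (s n) = termPrefix (s (N i)) := by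
    intro i n h1 h2
    rw [hNsucc] at h2
    have := (simulate_block hs (hidle i) (p := tag (N i)) rfl).2.2 (n - N i) (by omega)
    rwa [Nat.add_sub_cancel' h1] at this
  refine ⟨fun i => G.forget (s (N i)), fun i => tag (N i), ?_, ?_, ?_, ?_, ?_⟩
  · change G.forget (s 0) = _
    rw [hs0]
    rfl
  · exact fun i => (simulate_block hs (hidle i) rfl).1
  · intro n
    obtain ⟨m, hm⟩ := hgrow n
    obtain ⟨i, h1, h2⟩ := exists_block hN rfl m
    refine ⟨i, ?_⟩
    rw [termPrefix_map, ← (hblock i m h1 h2).2]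
    exact hm
  · intro i
    rw [termPrefix_map]
    exact hmatch (N i)
  · have h := (isAccepting_pullbackAcc (P' := G.TripleP) σ ρ _ G.acc d).1 hacc
    unfold IsAccepting at h ⊢
    rwa [← sigmaSet_eq_of_blocks σ (g := tag) hN rfl fun i n h1 h2 => (hblock i n h1 h2).1]

/-- A leftmost derivation in which each left-hand side is consumed symbol by symbol: at time `n`
the leftmost nonterminal of `form n` is consumed as the symbol at `cursor n`. -/
structure FineRun (G : OmegaPSG T) where
  cursor : ℕ → G.Cursor
  form : ℕ → List (G.N ⊕ T)
  left : ℕ → List (G.N ⊕ T)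
  right : ℕ → List (G.N ⊕ T)
  isTerminal_left : ∀ n, IsTerminal (left n)
  form_eq : ∀ n, form n = left n ++ Sum.inl (G.symbol (cursor n)) :: right n
  continue_lhs : ∀ n (h : (cursor n).2.val + 1 < (G.lhs (cursor n).1).length),
    cursor (n + 1) = ⟨(cursor n).1, ⟨(cursor n).2.val + 1, h⟩⟩ ∧
    form (n + 1) = left n ++ right n ∧ ∃ B w, right n = Sum.inl B :: w
  finish_lhs : ∀ n, (cursor n).2.val + 1 = (G.lhs (cursor n).1).length →
    (cursor (n + 1)).2.val = 0 ∧ form (n + 1) = left n ++ G.rhs (cursor n).1 ++ right n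

namespace FineRun

variable (R : FineRun G)

theorem height_form (n : ℕ) : height (R.form n) = height (R.right n) + 1 := by
  rw [R.form_eq, height_append, height_inl, (R.isTerminal_left n).height_eq, Nat.zero_add]

theorem right_suffix (n : ℕ) : R.right n <:+ R.form (n + 1) := by
  rcases Nat.lt_or_eq_of_le (Nat.succ_le_of_lt (R.cursor n).2.isLt) with h | h
  · rw [(R.continue_lhs n h).2.1]
    exact List.suffix_append _ _
  · rw [(R.finish_lhs n h).2]
    exact List.suffix_append _ _

open Classical in
/-- The phase at the first time from `n` on at which at most `t` nonterminals are left. -/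
noncomputable def phaseBelow (n t : ℕ) : Phase G.Cursor :=
  if h : ∃ j, height (R.form (n + j)) ≤ t then G.phase (R.cursor (n + Nat.find h)) else .dead

theorem phaseBelow_of_le {n t : ℕ} (h : height (R.form n) ≤ t) :
    R.phaseBelow n t = G.phase (R.cursor n) := by
  have hex : ∃ j, height (R.form (n + j)) ≤ t := ⟨0, h⟩
  have h0 : Nat.find hex = 0 := (Nat.find_eq_zero hex).2 h
  rw [phaseBelow, dif_pos hex, h0, Nat.add_zero]

theorem phaseBelow_succ {n t : ℕ} (h : t < height (R.form n)) :
    R.phaseBelow (n + 1) t = R.phaseBelow n t := by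
  unfold phaseBelow
  by_cases hex : ∃ j, height (R.form (n + j)) ≤ t
  · have hex' : ∃ j, height (R.form (n + (j + 1))) ≤ t := by
      obtain ⟨j, hj⟩ := hex
      cases j with
      | zero => exact absurd hj (by simpa using h)
      | succ j => exact ⟨j, hj⟩
    have hex'' : ∃ j, height (R.form (n + 1 + j)) ≤ t := by
      simpa only [Nat.add_assoc, Nat.add_comm 1] using hex'
    have hfind : Nat.find hex = Nat.find hex'' + 1 := by
      rw [Nat.find_comp_succ hex hex' (by simpa using h)]
      congr 2
      ext j
      rw [Nat.add_assoc, Nat.add_comm 1]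
    rw [dif_pos hex, dif_pos hex'', hfind, Nat.add_assoc, Nat.add_comm 1]
  · have hex'' : ¬ ∃ j, height (R.form (n + 1 + j)) ≤ t := by
      rintro ⟨j, hj⟩
      exact hex ⟨1 + j, by rwa [← Nat.add_assoc]⟩
    rw [dif_neg hex, dif_neg hex'']

theorem phaseBelow_cases (n t : ℕ) : R.phaseBelow n t = .dead ∨
    ∃ j, height (R.form (n + j)) ≤ t ∧ (∀ i < j, t < height (R.form (n + i))) ∧
      R.phaseBelow n t = G.phase (R.cursor (n + j)) := by
  unfold phaseBelow
  split
  · next h =>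
    exact Or.inr ⟨Nat.find h, Nat.find_spec h, fun i hi => not_le.1 (Nat.find_min h hi), rfl⟩
  · exact Or.inl rfl

theorem phaseBelow_zero (n : ℕ) : R.phaseBelow n 0 = .dead := by
  rcases R.phaseBelow_cases n 0 with h | ⟨j, hj, -⟩
  · exact h
  · rw [height_form] at hj
    omega

/-- No left-hand side is being matched when a terminal inside the form is crossed. -/
theorem phaseBelow_ne_mid {n : ℕ} {a : T} {v : List (G.N ⊕ T)}
    (hv : Sum.inr a :: v <:+ R.form n) (hlt : height v < height (R.form n)) (c : G.Cursor) :
    R.phaseBelow n (height v) ≠ .mid c := by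
  rcases R.phaseBelow_cases n (height v) with h | ⟨j, hj, hmin, h⟩
  · simp [h]
  have hsuff : ∀ i < j, Sum.inr a :: v <:+ R.right (n + i) := by
    have hstep : ∀ i < j, Sum.inr a :: v <:+ R.form (n + i) →
        Sum.inr a :: v <:+ R.right (n + i) := by
      intro i hi hf
      have hlt := hmin i hi
      rw [height_form] at hlt
      rw [R.form_eq] at hf
      exact suffix_of_height_le hf (by simpa using Nat.lt_succ_iff.1 hlt)
    intro i hi
    refine hstep i hi ?_
    induction i with
    | zero => exact hv
    | succ i ih => exact (hstep i (by omega) (ih (by omega))).trans (R.right_suffix _)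
  rw [h]
  cases j with
  | zero =>
    rw [Nat.add_zero] at hj
    omega
  | succ j =>
    have hs := hsuff j (by omega)
    rw [← Nat.add_assoc] at hj ⊢
    rcases Nat.lt_or_eq_of_le (Nat.succ_le_of_lt (R.cursor (n + j)).2.isLt) with hk | hk
    · obtain ⟨-, hform, B, w, hw⟩ := R.continue_lhs _ hk
      rw [hform, hw, height_append, height_inl] at hj
      rw [hw] at hs
      rcases List.suffix_cons_iff.1 hs with hs | hs
      · simp at hs
      · have := height_le_of_suffix hs
        simp at this
        omega
    · simp [phase, (R.finish_lhs _ hk).1]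

/-- The annotated form at time `n`. -/
noncomputable def tripleForm (n : ℕ) : List (G.TripleN ⊕ T) :=
  decorate (R.phaseBelow n) (R.form n)

/-- The word produced at time `n`, annotated. -/
noncomputable def output (n : ℕ) : List (G.TripleN ⊕ T) :=
  decorate (fun t => R.phaseBelow (n + 1) (t + height (R.right n)))
    (if (R.cursor n).2.val + 1 < (G.lhs (R.cursor n).1).length then []
      else G.rhs (R.cursor n).1)

theorem phaseBelow_right (n : ℕ) :
    R.phaseBelow (n + 1) (height (R.right n)) = R.phaseBelow n (height (R.right n)) :=
  R.phaseBelow_succ (by rw [height_form]; omega)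

theorem validRule (n : ℕ) :
    G.ValidRule (R.cursor n, R.phaseBelow n (height (R.right n)), R.output n) := by
  rcases Nat.lt_or_eq_of_le (Nat.succ_le_of_lt (R.cursor n).2.isLt) with h | h
  · obtain ⟨hcur, hform, -⟩ := R.continue_lhs n h
    refine Or.inl ⟨h, ?_, ?_⟩
    · simp only [output]
      rw [if_pos h]
      rfl
    · dsimp only
      rw [← phaseBelow_right, R.phaseBelow_of_le, hcur]
      · simp [phase]
      · rw [hform, height_append, (R.isTerminal_left n).height_eq, Nat.zero_add]
  · obtain ⟨hcur, hform⟩ := R.finish_lhs n h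
    have hheight : height (R.form (n + 1)) = height (G.rhs (R.cursor n).1) + height (R.right n) := by
      rw [hform, height_append, height_append, (R.isTerminal_left n).height_eq, Nat.zero_add]
    have hidle : R.phaseBelow (n + 1) (height (R.form (n + 1))) = .idle := by
      rw [R.phaseBelow_of_le le_rfl]
      simp [phase, hcur]
    have hout : R.output n = decorate (fun t => R.phaseBelow (n + 1) (t + height (R.right n)))
        (G.rhs (R.cursor n).1) := by
      simp only [output]
      rw [if_neg (Nat.not_lt.2 h.ge)]
    refine Or.inr ⟨h, ?_, ?_⟩
    · dsimp only
      rw [hout]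
      exact map_decorate _ _
    · dsimp only
      have := chain_decorate (D := fun t => R.phaseBelow (n + 1) (t + height (R.right n)))
        (x := G.rhs (R.cursor n).1) fun a v hv c => by
          have hle := height_le_of_suffix hv
          rw [height_inr] at hle
          rcases Nat.lt_or_eq_of_le hle with hlt | heq
          · have := R.phaseBelow_ne_mid (n := n + 1) (a := a) (v := v ++ R.right n) (by
              rw [hform, List.append_assoc]
              obtain ⟨y, hy⟩ := hv
              exact ⟨R.left n ++ y, by simp [← hy]⟩) (by rw [hheight, height_append]; omega) c
            simpa using this
          · simp only [heq]
            rw [← hheight, hidle]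
            simp
      simp only [Nat.zero_add, ← hheight, hidle] at this
      rwa [phaseBelow_right, ← hout] at this

/-- The production of the simulating grammar applied at time `n`. -/
noncomputable def rule (n : ℕ) : G.TripleP := ⟨_, R.validRule n⟩

theorem tripleStep (n : ℕ) : TripleStep (R.rule n) (R.tripleForm n) (R.tripleForm (n + 1)) := by
  have hform : R.form (n + 1) = R.left n ++ ((if (R.cursor n).2.val + 1 <
      (G.lhs (R.cursor n).1).length then [] else G.rhs (R.cursor n).1) ++ R.right n) := by
    rcases Nat.lt_or_eq_of_le (Nat.succ_le_of_lt (R.cursor n).2.isLt) with h | h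
    · rw [(R.continue_lhs n h).2.1, if_pos h, List.nil_append]
    · rw [(R.finish_lhs n h).2, if_neg (Nat.not_lt.2 h.ge), List.append_assoc]
  have hhead : R.phaseBelow n (height (R.right n) + 1) = G.phase (R.cursor n) :=
    R.phaseBelow_of_le (R.height_form n).le
  refine ⟨decorate (R.phaseBelow n) (R.left n), decorate (R.phaseBelow n) (R.right n),
    isTerminal_decorate _ (R.isTerminal_left n), ?_, ?_⟩
  · rw [tripleForm, R.form_eq, decorate_append, decorate_terminal _ _ (R.isTerminal_left n)]
    simp only [decorate, hhead]
    rfl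
  · rw [tripleForm, hform, decorate_append, decorate_append,
      decorate_terminal _ (R.phaseBelow n) (R.isTerminal_left n), List.append_assoc]
    congr 2
    exact decorate_congr fun t ht => R.phaseBelow_succ (by rw [height_form]; omega)

end FineRun

section Refine

variable (d : ℕ → G.P)

/-- The position following `c` in the left-hand sides of a sequence of productions. -/
def scanNext (c : Σ i : ℕ, Fin (G.lhs (d i)).length) : Σ i : ℕ, Fin (G.lhs (d i)).length :=
  if h : c.2.val + 1 < (G.lhs (d c.1)).length then ⟨c.1, ⟨c.2.val + 1, h⟩⟩
  else ⟨c.1 + 1, ⟨0, G.lhs_length_pos _⟩⟩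

/-- The successive positions in the left-hand sides of a sequence of productions. -/
def scan : ℕ → Σ i : ℕ, Fin (G.lhs (d i)).length
  | 0 => ⟨0, ⟨0, G.lhs_length_pos _⟩⟩
  | n + 1 => scanNext d (scan n)

/-- The time at which `scan` reaches the `i`-th production. -/
def scanTime : ℕ → ℕ
  | 0 => 0
  | i + 1 => scanTime i + (G.lhs (d i)).length

theorem scan_scanTime_add (i k : ℕ) (hk : k < (G.lhs (d i)).length) :
    scan d (scanTime d i + k) = ⟨i, ⟨k, hk⟩⟩ := by
  induction i generalizing k with
  | zero =>
    induction k with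
    | zero => rfl
    | succ k ih =>
      rw [← Nat.add_assoc, scan, ih (by omega)]
      exact dif_pos hk
  | succ i ihi =>
    induction k with
    | zero =>
      obtain ⟨L, hL⟩ := Nat.exists_eq_succ_of_ne_zero (G.lhs_length_pos (d i)).ne'
      rw [Nat.add_zero, scanTime, hL, Nat.succ_eq_add_one, ← Nat.add_assoc, scan,
        ihi L (by omega)]
      exact dif_neg (by simp only; omega)
    | succ k ih =>
      rw [← Nat.add_assoc, scan, ih (by omega)]
      exact dif_pos hk

/-- Consume the left-hand sides of a leftmost derivation symbol by symbol. -/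
def refineRun {s u v : ℕ → List (G.N ⊕ T)} (hu : ∀ i, IsTerminal (u i))
    (hs : ∀ i, s i = u i ++ (G.lhs (d i)).map Sum.inl ++ v i)
    (hs' : ∀ i, s (i + 1) = u i ++ G.rhs (d i) ++ v i) : FineRun G where
  cursor n := ⟨d (scan d n).1, (scan d n).2⟩
  form n := u (scan d n).1 ++
    ((G.lhs (d (scan d n).1)).drop (scan d n).2.val).map Sum.inl ++ v (scan d n).1
  left n := u (scan d n).1
  right n := ((G.lhs (d (scan d n).1)).drop ((scan d n).2.val + 1)).map Sum.inl ++ v (scan d n).1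
  isTerminal_left n := hu _
  form_eq n := by
    rw [List.drop_eq_getElem_cons (scan d n).2.isLt]
    simp only [List.map_cons, List.append_assoc, List.cons_append]
    rfl
  continue_lhs n h := by
    have hscan : scan d (n + 1) = ⟨(scan d n).1, ⟨(scan d n).2.val + 1, h⟩⟩ := dif_pos h
    rw [hscan]
    refine ⟨rfl, by simp, ?_⟩
    rw [List.drop_eq_getElem_cons h]
    exact ⟨_, _, rfl⟩
  finish_lhs n h := by
    have hscan : scan d (n + 1) = ⟨(scan d n).1 + 1, ⟨0, G.lhs_length_pos _⟩⟩ :=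
      dif_neg (Nat.not_lt.2 h.ge)
    rw [hscan]
    refine ⟨rfl, ?_⟩
    simp only [List.drop_zero]
    rw [← hs, hs']
    simp only at h
    simp [h]

end Refine

theorem Lang_subset_toCFG [Finite T] (σ : AccSigma) (ρ : AccRho) :
    G.Lang σ ρ .l ⊆ (G.toCFG ρ).Lang σ ρ .l := by
  rintro x ⟨s, d, hs0, hs, hgrow, hmatch, hacc⟩
  choose u v hu hsu hsv using hs
  let R := refineRun d hu hsu hsv
  have hN : StrictMono (scanTime d) := strictMono_nat_of_lt_succ fun i => by
    have := G.lhs_length_pos (d i)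
    rw [scanTime]
    omega
  have hscan : ∀ i n, scanTime d i ≤ n → n < scanTime d (i + 1) → (scan d n).1 = i := by
    intro i n h1 h2
    rw [scanTime] at h2
    have := scan_scanTime_add d i (n - scanTime d i) (by omega)
    rw [Nat.add_sub_cancel' h1] at this
    rw [this]
  have hpre : ∀ n, termPrefix (R.tripleForm n) = termPrefix (s (scan d n).1) := by
    intro n
    rw [← termPrefix_map (fun X : G.TripleN => X.2.1), FineRun.tripleForm, map_decorate,
      R.form_eq, termPrefix_append_inl, hsu]
    obtain ⟨A, w, hA⟩ := List.exists_cons_of_ne_nil (G.lhs_ne (d (scan d n).1))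
    rw [hA, List.map_cons, List.append_assoc, List.cons_append, termPrefix_append_inl]
    rfl
  have hform0 : R.form 0 = [Sum.inl G.start] := by
    rw [← hs0, hsu 0]
    rfl
  refine ⟨R.tripleForm, R.rule, ?_, fun n => toCFG_LStep_iff.2 (R.tripleStep n), ?_, ?_, ?_⟩
  · rw [FineRun.tripleForm, hform0]
    have h1 : R.phaseBelow 0 1 = .idle := R.phaseBelow_of_le (by simp [hform0])
    simp [decorate, R.phaseBelow_zero, h1, toCFG]
  · intro n
    obtain ⟨i, hi⟩ := hgrow n
    refine ⟨scanTime d i, hi.trans_eq ?_⟩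
    have := hpre (scanTime d i)
    rw [hscan i _ le_rfl (hN (Nat.lt_succ_self i))] at this
    exact congrArg List.length this.symm
  · intro n
    have := hmatch (scan d n).1
    rw [← hpre n] at this
    exact this
  · refine (isAccepting_pullbackAcc (P' := G.TripleP) σ ρ _ G.acc R.rule).2 ?_
    unfold IsAccepting at hacc ⊢
    rwa [sigmaSet_eq_of_blocks σ (f := d) hN rfl fun i n h1 h2 => by
      change d (scan d n).1 = d i
      rw [hscan i n h1 h2]]

end OmegaPSG

end OmegaFormal

open OmegaFormal

/-- Theorem: 𝓛_{σ,ρ,l}(ω-PSG) = 𝓛_{σ,ρ,l}(ω-CFG) for every acceptance mode (σ,ρ). -/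
theorem psg_l_eq_cfg_l (T : Type) [Fintype T] (σ : AccSigma) (ρ : AccRho) :
    GLang T (fun _ => True) σ ρ DerivMode.l = GLang T OmegaPSG.IsCFG σ ρ DerivMode.l := by
  ext L
  constructor
  · rintro ⟨G, -, rfl⟩
    exact ⟨G.toCFG ρ, fun _ => rfl,
      (OmegaPSG.Lang_subset_toCFG σ ρ).antisymm (OmegaPSG.toCFG_Lang_subset σ ρ)⟩
  · rintro ⟨G, -, rfl⟩
    exact ⟨G, trivial, rfl⟩
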